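/- arXiv:1007.1511 — 3 statements merged into one kernel-verified Lean document; each statement's English description precedes it below -/
import Mathlib

section
/- Let R be a commutative ring, m a natural number, A an m×m matrix over R, and c ∈ R. Then det(I_m − c·A) = Σ_{j=0}^{m} (−c)^j · Δ_j(A), where Δ_j(A) denotes the sum of all principal j×j minors of A (with Δ_0(A) = 1). -/
/-- The sum of all principal `k × k` minors of an `m × m` matrix `A`:
the sum over all `k`-element subsets `S` of the index set of the determinant of
the submatrix of `A` obtained by restricting rows and columns to `S`.
By convention this equals `1` for `k = 0`. -/
def principalMinorSum {R : Type*} [CommRing R] {m : ℕ}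
    (A : Matrix (Fin m) (Fin m) R) (k : ℕ) : R :=
  ∑ S ∈ Finset.powersetCard k (Finset.univ : Finset (Fin m)),
    (A.submatrix (Subtype.val : {x // x ∈ S} → Fin m) Subtype.val).det

theorem det_one_sub_smul_eq_sum_principalMinorSum
    {R : Type*} [CommRing R] {m : ℕ} (A : Matrix (Fin m) (Fin m) R) (c : R) :
    ((1 : Matrix (Fin m) (Fin m) R) - c • A).det =
      ∑ j ∈ Finset.range (m + 1), (-c) ^ j * principalMinorSum A j := by
  set p : Polynomial R := (1 + (Polynomial.X : Polynomial R) • A.map Polynomial.C).det with hp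
  have hdeg : p.natDegree < m + 1 := by
    have h := Polynomial.natDegree_det_X_add_C_le A (1 : Matrix (Fin m) (Fin m) R)
    rw [Matrix.map_one _ (map_zero _) (map_one _), add_comm, Fintype.card_fin] at h
    exact Nat.lt_succ_of_le h
  have heval : (1 - c • A).det = p.eval (-c) := by
    rw [hp, ← Polynomial.coe_evalRingHom, RingHom.map_det]
    congr 1
    ext i j
    by_cases hij : i = j <;> simp [hij, sub_eq_add_neg, mul_comm c]
  rw [heval, Polynomial.eval_eq_sum_range' hdeg]
  refine Finset.sum_congr rfl fun j _ => ?_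
  rw [hp, Matrix.coeff_det_one_add_X_smul_eq_sum_minors, mul_comm]
  rfl
end

section
/- Let R be a commutative ℚ-algebra, m a natural number, A an m×m matrix over R, and 1 ≤ j ≤ m. Then Δ_j(A) = (1/j!) · Σ_{a,b : Fin j → Fin m} δ^{b_1…b_j}_{a_1…a_j} · A_{a_1 b_1} ⋯ A_{a_j b_j}, where the generalized Kronecker delta δ^{b_1…b_j}_{a_1…a_j} is the determinant of the j×j matrix whose (i,k) entry is 1 if a_i = b_k and 0 otherwise, and Δ_j(A) denotes the sum of all principal j×j minors of A. -/
/-- Contracting a product of matrix entries with the generalized Kronecker delta over the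
column indices gives the determinant of the matrix with repeated rows and columns. -/
theorem sum_kronecker_delta_mul_prod {R ι κ : Type*} [CommRing R] [Fintype ι] [DecidableEq ι]
    [Fintype κ] [DecidableEq κ] (A : Matrix κ κ R) (a : ι → κ) :
    ∑ b : ι → κ, Matrix.det (fun i k : ι => if a i = b k then (1 : R) else 0) *
      ∏ i, A (a i) (b i) = (A.submatrix a a).det := by
  rw [← Matrix.det_transpose (A.submatrix a a)]
  have h_delta (b : ι → κ) : Matrix.det (fun i k : ι => if a i = b k then (1 : R) else 0) =
      ∑ σ : Equiv.Perm ι, ((Equiv.Perm.sign σ : ℤ) : R) *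
        ∏ k, if a (σ k) = b k then (1 : R) else 0 := Matrix.det_apply' _
  simp_rw [h_delta, Matrix.det_apply', Finset.sum_mul]
  rw [Finset.sum_comm]
  refine Finset.sum_congr rfl fun σ _ => ?_
  rw [Finset.sum_eq_single (a ∘ σ)]
  · simp
  · intro b _ hb
    obtain ⟨k, hk⟩ := Function.ne_iff.mp hb
    rw [Finset.prod_eq_zero (Finset.mem_univ k) (if_neg (Ne.symm hk))]
    simp
  · simp

/-- Each principal `j × j` minor arises from exactly `j!` injective index tuples. -/
theorem sum_det_submatrix_eq_factorial_mul_principalMinorSum {R : Type*} [CommRing R] {m : ℕ}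
    (A : Matrix (Fin m) (Fin m) R) (j : ℕ) :
    ∑ a : Fin j → Fin m, (A.submatrix a a).det = j.factorial * principalMinorSum A j := by
  classical
  have h_inj : ∑ a : Fin j → Fin m, (A.submatrix a a).det =
      ∑ a : Fin j → Fin m with Function.Injective a, (A.submatrix a a).det := by
    refine (Finset.sum_filter_of_ne fun a _ h => ?_).symm
    by_contra h_not
    obtain ⟨i, k, hik, hne⟩ := Function.not_injective_iff.mp h_not
    exact h (Matrix.det_zero_of_row_eq hne (by ext l; simp [hik]))
  have h_maps : ∀ a ∈ Finset.univ.filter (fun a : Fin j → Fin m => Function.Injective a),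
      Finset.univ.image a ∈ Finset.powersetCard j (Finset.univ : Finset (Fin m)) := by
    intro a ha
    rw [Finset.mem_powersetCard_univ, Finset.card_image_of_injective _ (Finset.mem_filter.mp ha).2,
      Finset.card_fin]
  rw [h_inj, ← Finset.sum_fiberwise_of_maps_to h_maps, principalMinorSum, Finset.mul_sum]
  refine Finset.sum_congr rfl fun S hS => ?_
  have h_card : Fintype.card (Fin j) = Fintype.card S := by
    simp [Finset.mem_powersetCard_univ.mp hS]
  have h_fiber : ∑ _e : Fin j ≃ S,
      (A.submatrix (Subtype.val : {x // x ∈ S} → Fin m) Subtype.val).det =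
      j.factorial * (A.submatrix (Subtype.val : {x // x ∈ S} → Fin m) Subtype.val).det := by
    simp [Fintype.card_equiv (Fintype.equivOfCardEq h_card)]
  rw [← h_fiber]
  symm
  refine Finset.sum_bij (fun e _ => Subtype.val ∘ e) ?_ ?_ ?_ ?_
  · intro e _
    simp only [Finset.mem_filter, Finset.mem_univ, true_and]
    refine ⟨Subtype.val_injective.comp e.injective, ?_⟩
    rw [← Finset.image_image, Finset.image_univ_equiv, Finset.univ_eq_attach,
      Finset.attach_image_val]
  · intro e _ e' _ h
    ext i
    exact congrArg Fin.val (congrFun h i)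
  · intro a ha
    simp only [Finset.mem_filter, Finset.mem_univ, true_and] at ha
    obtain ⟨ha, rfl⟩ := ha
    have h_bij : Function.Bijective (fun i => (⟨a i, Finset.mem_image_of_mem a (Finset.mem_univ i)⟩ :
        {x // x ∈ Finset.univ.image a})) :=
      (Fintype.bijective_iff_injective_and_card _).mpr
        ⟨fun i k h => ha (congrArg Subtype.val h), h_card⟩
    exact ⟨Equiv.ofBijective _ h_bij, Finset.mem_univ _, rfl⟩
  · intro e _
    rw [← Matrix.submatrix_submatrix, Matrix.det_submatrix_equiv_self]

theorem principalMinorSum_eq_kronecker_delta_sum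
    {R : Type*} [CommRing R] [Algebra ℚ R] {m : ℕ} (A : Matrix (Fin m) (Fin m) R)
    (j : ℕ) (hj1 : 1 ≤ j) (hjm : j ≤ m) :
    principalMinorSum A j =
      (1 / (j.factorial : ℚ)) •
        ∑ a : Fin j → Fin m, ∑ b : Fin j → Fin m,
          (Matrix.det (fun i k : Fin j => if a i = b k then (1 : R) else 0)) *
            ∏ i : Fin j, A (a i) (b i) := by
  simp_rw [sum_kronecker_delta_mul_prod]
  rw [sum_det_submatrix_eq_factorial_mul_principalMinorSum, ← nsmul_eq_mul,
    ← Nat.cast_smul_eq_nsmul ℚ, smul_smul,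
    one_div_mul_cancel (Nat.cast_ne_zero.mpr j.factorial_ne_zero), one_smul]
end

section
/- Let R be a commutative ring, m a natural number, A an m×m matrix over R, t ∈ R, and 0 ≤ j ≤ m. Then Δ_j(A + t·I_m) = Σ_{k=0}^{j} C(m−j+k, k) · Δ_{j−k}(A) · t^k, where C(·,·) is the binomial coefficient and Δ_k(A) denotes the sum of all principal k×k minors of A (with Δ_0(A) = 1). -/
theorem principalMinorSum_eq_charpoly_coeff {R : Type*} [CommRing R] {m : ℕ}
    (A : Matrix (Fin m) (Fin m) R) {k : ℕ} (hk : k ≤ m) :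
    principalMinorSum A k = (-1) ^ k * A.charpoly.coeff (m - k) := by
  have h := A.charpoly_coeff_eq_sum_minors k (by simpa using hk)
  rw [Fintype.card_fin] at h
  rw [h, ← mul_assoc, ← mul_pow, neg_one_mul, neg_neg, one_pow, one_mul, principalMinorSum]

theorem charpoly_add_smul_one {R : Type*} [CommRing R] {m : ℕ}
    (A : Matrix (Fin m) (Fin m) R) (t : R) :
    (A + t • (1 : Matrix (Fin m) (Fin m) R)).charpoly = Polynomial.taylor (-t) A.charpoly := by
  rw [Polynomial.taylor_apply, ← Matrix.charpoly_sub_scalar, map_neg, sub_neg_eq_add,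
    Matrix.scalar_apply, Matrix.smul_one_eq_diagonal]

/-- The coefficients of a Taylor shift of a polynomial of degree at most `i + j`. -/
theorem coeff_taylor_eq_sum_range {R : Type*} [CommRing R] (p : Polynomial R) (r : R)
    {i j : ℕ} (hp : p.natDegree ≤ i + j) :
    (Polynomial.taylor r p).coeff i =
      ∑ k ∈ Finset.range (j + 1), ((i + k).choose k : R) * p.coeff (i + k) * r ^ k := by
  have hdeg : (Polynomial.hasseDeriv i p).natDegree < j + 1 := by
    have := Polynomial.natDegree_hasseDeriv_le p i
    lia
  rw [Polynomial.taylor_coeff, Polynomial.eval_eq_sum_range' hdeg]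
  refine Finset.sum_congr rfl fun k _ => ?_
  rw [Polynomial.hasseDeriv_coeff, add_comm k i, Nat.choose_symm_add]

theorem principalMinorSum_add_smul_one
    {R : Type*} [CommRing R] {m : ℕ} (A : Matrix (Fin m) (Fin m) R) (t : R)
    (j : ℕ) (hj : j ≤ m) :
    principalMinorSum (A + t • (1 : Matrix (Fin m) (Fin m) R)) j =
      ∑ k ∈ Finset.range (j + 1),
        ((m - j + k).choose k : R) * principalMinorSum A (j - k) * t ^ k := by
  nontriviality R
  have hdeg : A.charpoly.natDegree ≤ m - j + j := by
    rw [A.charpoly_natDegree_eq_dim, Fintype.card_fin, Nat.sub_add_cancel hj]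
  rw [principalMinorSum_eq_charpoly_coeff _ hj, charpoly_add_smul_one,
    coeff_taylor_eq_sum_range _ _ hdeg, Finset.mul_sum]
  refine Finset.sum_congr rfl fun k hk => ?_
  have hkj : k ≤ j := Nat.lt_succ_iff.mp (Finset.mem_range.mp hk)
  have hsign : (-1 : R) ^ j * (-1) ^ k = (-1) ^ (j - k) := by
    obtain ⟨i, rfl⟩ := Nat.exists_eq_add_of_le hkj
    rw [Nat.add_sub_cancel_left, pow_add, mul_right_comm, ← mul_pow, neg_one_mul, neg_neg,
      one_pow, one_mul]
  rw [principalMinorSum_eq_charpoly_coeff A ((Nat.sub_le j k).trans hj), ← hsign,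
    show m - (j - k) = m - j + k by lia, neg_pow t]
  ring
end
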